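/- The sequence of polynomials T_n(x,y,z) = Σ_{k=0}^n t_{n,k}(y,z)·x^k ∈ ℤ[x,y,z] is coefficientwise Hankel-totally positive: every minor of the infinite Hankel matrix (T_{n+n'}(x,y,z))_{n,n'≥0} is a polynomial in x, y, z all of whose coefficients are nonnegative integers. -/

import Mathlib

open scoped Classical

/-- A pair `T = (root, parent)` encodes a rooted tree on the vertex set
`Fin n` (vertices `1, …, n` of the paper correspond to `0, …, n-1`, in the
same order): the root is a fixed point of the parent function and every
vertex reaches the root under iteration of the parent function. -/
def IsRootedTree {n : ℕ} (T : Fin n × (Fin n → Fin n)) : Prop :=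
  T.2 T.1 = T.1 ∧ ∀ v, ∃ m : ℕ, T.2^[m] v = T.1

/-- The (finite) set of rooted trees on `Fin n`. -/
noncomputable def rootedTrees (n : ℕ) : Finset (Fin n × (Fin n → Fin n)) :=
  Finset.univ.filter IsRootedTree

/-- `d` is a descendant of `j` in the rooted tree `T`. -/
def Descends {n : ℕ} (T : Fin n × (Fin n → Fin n)) (d j : Fin n) : Prop :=
  ∃ m : ℕ, T.2^[m] d = j

/-- The edge of `T` from `T.2 j` to its child `j` is improper: some
descendant of `j` is smaller than `T.2 j`. -/
def ImproperEdge {n : ℕ} (T : Fin n × (Fin n → Fin n)) (j : Fin n) : Prop :=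
  ∃ d : Fin n, Descends T d j ∧ d < T.2 j

/-- The number of improper edges of the rooted tree `T`. -/
noncomputable def imprope {n : ℕ} (T : Fin n × (Fin n → Fin n)) : ℕ :=
  (Finset.univ.filter fun j => j ≠ T.1 ∧ ImproperEdge T j).card

/-- The number of proper edges of the rooted tree `T`. -/
noncomputable def prope {n : ℕ} (T : Fin n × (Fin n → Fin n)) : ℕ :=
  (Finset.univ.filter fun j => j ≠ T.1 ∧ ¬ ImproperEdge T j).card

/-- The number of children of the vertex `i` in the rooted tree `T`. -/
noncomputable def childCount {n : ℕ} (T : Fin n × (Fin n → Fin n)) (i : Fin n) : ℕ :=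
  (Finset.univ.filter fun j => j ≠ T.1 ∧ T.2 j = i).card

/-- The polynomial `t_{n,k}(y,z) = Σ_T y^{imprope(T)} z^{prope(T)−k}`, the sum
over all rooted trees on `[n+1]` in which vertex `1` has exactly `k`
children, evaluated at elements `y, z` of a commutative ring `A`. -/
noncomputable def tnkYZ {A : Type*} [CommRing A] (y z : A) (n k : ℕ) : A :=
  ∑ T ∈ (rootedTrees (n + 1)).filter (fun T => childCount T 0 = k),
    y ^ imprope T * z ^ (prope T - k)


/-- The row-generating polynomial `T_n(x,y,z) = Σ_{k=0}^n t_{n,k}(y,z)·x^k`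
in `ℤ[x,y,z]`, where `x, y, z` are the variables `X 0, X 1, X 2` of
`MvPolynomial (Fin 3) ℤ`. -/
noncomputable def TnXYZ (n : ℕ) : MvPolynomial (Fin 3) ℤ :=
  ∑ k ∈ Finset.range (n + 1),
    tnkYZ (MvPolynomial.X 1) (MvPolynomial.X 2) n k * MvPolynomial.X 0 ^ k

namespace Matrix

variable {R : Type*} [CommRing R]

/-- Cauchy–Binet formula. -/
theorem det_mul_eq_sum_orderEmbedding {n : Type*} [Fintype n] [LinearOrder n] {k : ℕ}
    (A : Matrix (Fin k) n R) (B : Matrix n (Fin k) R) :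
    (A * B).det = ∑ g : Fin k ↪o n, (A.submatrix id g).det * (B.submatrix g id).det := by
  have h1 : (A * B).det = ∑ f : Fin k → n, (∏ i, A i (f i)) * (B.submatrix f id).det := by
    have h : (A * B) = fun i => ∑ j, A i j • B j := by
      ext i l
      simp [Matrix.mul_apply, Finset.sum_apply]
    have h2 := (detRowAlternating (R := R) (n := Fin k)).toMultilinearMap.map_sum
      (fun i j => A i j • B j)
    rw [h]
    refine h2.trans (Finset.sum_congr rfl fun f _ => ?_)
    exact (detRowAlternating (R := R) (n := Fin k)).toMultilinearMap.map_smul_univ _ _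
  have h3 : ∀ g : Fin k ↪o n, (A.submatrix id g).det * (B.submatrix g id).det =
      ∑ σ : Equiv.Perm (Fin k), (∏ i, A i (g (σ i))) * (B.submatrix (g ∘ σ) id).det := by
    intro g
    rw [← det_transpose (A.submatrix id g), det_apply', Finset.sum_mul]
    refine Finset.sum_congr rfl fun σ _ => ?_
    have : B.submatrix (g ∘ σ) id = (B.submatrix g id).submatrix σ id := rfl
    rw [this, det_permute]
    simp only [transpose_apply, submatrix_apply, id]
    ring
  rw [h1, Finset.sum_congr rfl fun g _ => h3 g, Finset.sum_sigma', eq_comm]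
  refine Finset.sum_of_injOn (fun p : (_ : Fin k ↪o n) × Equiv.Perm (Fin k) => p.1 ∘ p.2)
    ?_ (fun _ _ => Finset.mem_coe.2 (Finset.mem_univ _)) ?_ (fun p _ => rfl)
  · rintro ⟨g, σ⟩ - ⟨g', σ'⟩ - h
    have h : (g : Fin k → n) ∘ σ = g' ∘ σ' := h
    have hr : Set.range g = Set.range g' := by
      rw [← σ.surjective.range_comp g, ← σ'.surjective.range_comp g', h]
    have hg : g = g' := DFunLike.coe_injective ((g.strictMono.range_inj g'.strictMono).1 hr)
    subst hg
    have : σ = σ' := Equiv.ext fun i => g.injective (congrFun h i)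
    rw [this]
  · intro f _ hf
    by_cases hinj : Function.Injective f
    · exfalso
      refine hf ⟨⟨OrderEmbedding.ofStrictMono (f ∘ Tuple.sort f)
        ((Tuple.monotone_sort f).strictMono_of_injective
          (hinj.comp (Tuple.sort f).injective)), (Tuple.sort f)⁻¹⟩, by simp, ?_⟩
      ext i
      simp
    · obtain ⟨i, j, hij, hne⟩ := Function.not_injective_iff.1 hinj
      rw [det_zero_of_row_eq hne (by ext l; simp [hij]), mul_zero]

/-- A matrix is totally positive with respect to a subsemiring `P` of nonnegative elements
if all its minors lie in `P`. -/
def IsTotallyPositive (P : Subsemiring R) {m n : Type*} [Preorder m] [Preorder n]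
    (M : Matrix m n R) : Prop :=
  ∀ (k : ℕ) (f : Fin k → m) (g : Fin k → n), StrictMono f → StrictMono g →
    (M.submatrix f g).det ∈ P

namespace IsTotallyPositive

variable {P : Subsemiring R}

theorem mul {l m n : Type*} [Preorder l] [Fintype m] [LinearOrder m] [Preorder n]
    {M : Matrix l m R} {N : Matrix m n R}
    (hM : M.IsTotallyPositive P) (hN : N.IsTotallyPositive P) :
    (M * N).IsTotallyPositive P := by
  intro k f g hf hg
  have : (M * N).submatrix f g = M.submatrix f id * N.submatrix id g := by
    ext; simp [Matrix.mul_apply]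
  rw [this, det_mul_eq_sum_orderEmbedding]
  exact sum_mem fun e _ => mul_mem (hM k f e hf e.strictMono) (hN k e g e.strictMono hg)

theorem transpose {m n : Type*} [Preorder m] [Preorder n] {M : Matrix m n R}
    (hM : M.IsTotallyPositive P) : Mᵀ.IsTotallyPositive P := by
  intro k f g hf hg
  rw [← transpose_submatrix, det_transpose]
  exact hM k g f hg hf

theorem submatrix {m n m' n' : Type*} [Preorder m] [Preorder n] [Preorder m'] [Preorder n']
    {M : Matrix m n R} (hM : M.IsTotallyPositive P) {f : m' → m} {g : n' → n}
    (hf : StrictMono f) (hg : StrictMono g) : (M.submatrix f g).IsTotallyPositive P :=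
  fun k f' g' hf' hg' => hM k (f ∘ f') (g ∘ g') (hf.comp hf') (hg.comp hg')

end IsTotallyPositive

theorem det_eq_mul_of_row_zero {k : ℕ} (M : Matrix (Fin (k + 1)) (Fin (k + 1)) R)
    (h : ∀ j : Fin k, M 0 j.succ = 0) :
    M.det = M 0 0 * (M.submatrix Fin.succ Fin.succ).det := by
  rw [det_succ_row_zero, Fin.sum_univ_succ]
  simp [h]

theorem det_eq_mul_of_column_zero {k : ℕ} (M : Matrix (Fin (k + 1)) (Fin (k + 1)) R)
    (h : ∀ i : Fin k, M i.succ 0 = 0) :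
    M.det = M 0 0 * (M.submatrix Fin.succ Fin.succ).det := by
  rw [← det_transpose, det_eq_mul_of_row_zero _ h, ← transpose_submatrix, det_transpose]
  rfl

/-- The upper bidiagonal matrix with constant diagonal `x` and superdiagonal `1`. -/
def shiftAdd (x : R) : Matrix ℕ ℕ R :=
  of fun i j => if j = i then x else if j = i + 1 then 1 else 0

/-- The lower triangular matrix of the operator `h ↦ h / (1 - y s)` in the basis `s ^ k / k!`. -/
def geomMatrix (y : R) : Matrix ℕ ℕ R :=
  of fun i j => if j ≤ i then ∏ l ∈ Finset.Ioc j i, ((l : R) * y) else 0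

/-- The lower triangular matrix of the operator `h ↦ exp (z s) h` in the basis `s ^ k / k!`. -/
def binomMatrix (z : R) : Matrix ℕ ℕ R :=
  of fun i j => (i.choose j : R) * z ^ (i - j)

theorem isTotallyPositive_shiftAdd {P : Subsemiring R} {x : R} (hx : x ∈ P) :
    (shiftAdd x).IsTotallyPositive P := by
  intro k
  induction k with
  | zero => intro f g _ _; simp [one_mem]
  | succ k ih =>
    intro f g hf hg
    have key : ((shiftAdd x).submatrix f g).det = shiftAdd x (f 0) (g 0) *
        (((shiftAdd x).submatrix f g).submatrix Fin.succ Fin.succ).det := by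
      by_cases h : f 0 < g 0
      · refine det_eq_mul_of_row_zero _ fun j => ?_
        have : g 0 < g j.succ := hg (Fin.succ_pos j)
        simp only [submatrix_apply, shiftAdd, of_apply]
        rw [if_neg (by omega), if_neg (by omega)]
      · refine det_eq_mul_of_column_zero _ fun i => ?_
        have : f 0 < f i.succ := hf (Fin.succ_pos i)
        simp only [submatrix_apply, shiftAdd, of_apply]
        rw [if_neg (by omega), if_neg (by omega)]
    rw [key]
    refine mul_mem ?_ (ih (f ∘ Fin.succ) (g ∘ Fin.succ) (hf.comp Fin.strictMono_succ)
      (hg.comp Fin.strictMono_succ))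
    simp only [shiftAdd, of_apply]
    split_ifs
    exacts [hx, one_mem _, zero_mem _]

theorem isTotallyPositive_geomMatrix {P : Subsemiring R} {y : R} (hy : y ∈ P) :
    (geomMatrix y).IsTotallyPositive P := by
  intro k
  induction k with
  | zero => intro f g _ _; simp [one_mem]
  | succ k ih =>
    intro f g hf hg
    by_cases h : ∃ j : Fin k, g j.succ ≤ f 0
    · obtain ⟨j, hj⟩ := h
      have h0 : g 0 < g j.succ := hg (Fin.succ_pos j)
      have hcol : ((geomMatrix y).submatrix f g) = ((geomMatrix y).submatrix f g).updateCol 0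
          ((∏ l ∈ Finset.Ioc (g 0) (g j.succ), ((l : R) * y)) •
            fun i => geomMatrix y (f i) (g j.succ)) := by
        ext a b
        rw [updateCol_apply]
        split_ifs with hb
        · subst hb
          have : f 0 ≤ f a := hf.monotone (Fin.zero_le a)
          simp only [submatrix_apply, geomMatrix, of_apply, Pi.smul_apply, smul_eq_mul]
          rw [if_pos (by omega), if_pos (by omega), Finset.prod_Ioc_consecutive _ h0.le (by omega)]
        · rfl
      rw [hcol, det_updateCol_smul]
      have : det (((geomMatrix y).submatrix f g).updateCol 0
          fun i => geomMatrix y (f i) (g j.succ)) = 0 :=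
        det_zero_of_column_eq (Fin.succ_ne_zero j).symm fun i => by
          simp
      rw [this, mul_zero]
      exact zero_mem _
    · push Not at h
      have key : ((geomMatrix y).submatrix f g).det = geomMatrix y (f 0) (g 0) *
          (((geomMatrix y).submatrix f g).submatrix Fin.succ Fin.succ).det := by
        refine det_eq_mul_of_row_zero _ fun j => ?_
        simp only [submatrix_apply, geomMatrix, of_apply]
        rw [if_neg (not_le.2 (h j))]
      rw [key]
      refine mul_mem ?_ (ih (f ∘ Fin.succ) (g ∘ Fin.succ) (hf.comp Fin.strictMono_succ)
        (hg.comp Fin.strictMono_succ))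
      simp only [geomMatrix, of_apply]
      split_ifs
      exacts [prod_mem fun l _ => mul_mem (natCast_mem _ l) hy, zero_mem _]

/-- The output matrix of a totally positive production matrix is totally positive. -/
theorem IsTotallyPositive.output {P : Subsemiring R} {N : ℕ}
    {Q : Matrix (Fin (N + 1)) (Fin (N + 1)) R} (hQ : Q.IsTotallyPositive P) :
    (of fun (n : ℕ) k => (Q ^ n) 0 k).IsTotallyPositive P := by
  intro k
  induction k with
  | zero => intro f g _ _; simp [one_mem]
  | succ k ihk =>
    intro f
    generalize hm : f 0 = m
    induction m generalizing f with
    | zero =>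
      intro g hf hg
      rw [det_eq_mul_of_row_zero]
      · refine mul_mem ?_ (ihk (f ∘ Fin.succ) (g ∘ Fin.succ) (hf.comp Fin.strictMono_succ)
          (hg.comp Fin.strictMono_succ))
        simp only [submatrix_apply, of_apply, hm, pow_zero, one_apply]
        split_ifs
        exacts [one_mem _, zero_mem _]
      · intro j
        have : g 0 < g j.succ := hg (Fin.succ_pos j)
        simp only [submatrix_apply, of_apply, hm, pow_zero, one_apply]
        rw [if_neg]
        intro h
        rw [← h] at this
        exact absurd this (Fin.not_lt_zero _)
    | succ m ihm =>
      intro g hf hg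
      have hpos : ∀ i, 1 ≤ f i := fun i => by
        have : f 0 ≤ f i := hf.monotone (Fin.zero_le i)
        omega
      have hmul : (of fun (n : ℕ) k => (Q ^ n) 0 k).submatrix f g =
          (of fun (n : ℕ) k => (Q ^ n) 0 k).submatrix (fun i => f i - 1) id *
            Q.submatrix id g := by
        ext a b
        simp only [submatrix_apply, of_apply, Matrix.mul_apply, id]
        rw [← Matrix.mul_apply, ← pow_succ, Nat.sub_add_cancel (hpos a)]
      rw [hmul, det_mul_eq_sum_orderEmbedding]
      refine sum_mem fun e _ => mul_mem ?_ ?_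
      · refine ihm (fun i => f i - 1) (by simp [hm]) e (fun a b hab => ?_) e.strictMono
        have := hf hab
        have := hpos a
        simp only
        omega
      · exact hQ _ e g e.strictMono hg

/-- The Hankel matrix of the zeroth column entries of the powers of a totally positive matrix is
totally positive. -/
theorem IsTotallyPositive.hankel {P : Subsemiring R} {N : ℕ}
    {Q : Matrix (Fin (N + 1)) (Fin (N + 1)) R} (hQ : Q.IsTotallyPositive P) :
    (of fun n n' : ℕ => (Q ^ (n + n')) 0 0).IsTotallyPositive P := by
  have h : (of fun n n' : ℕ => (Q ^ (n + n')) 0 0) =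
      (of fun (n : ℕ) k => (Q ^ n) 0 k) * (of fun (n : ℕ) k => (Qᵀ ^ n) 0 k)ᵀ := by
    ext a b
    simp only [of_apply, Matrix.mul_apply, transpose_apply, ← transpose_pow]
    rw [pow_add, Matrix.mul_apply]
  rw [h]
  exact hQ.output.mul hQ.transpose.output.transpose

theorem binomMatrix_succ_zero (z : R) (n : ℕ) :
    binomMatrix z (n + 1) 0 = z * binomMatrix z n 0 := by
  simp [binomMatrix, pow_succ']

theorem binomMatrix_succ_succ (z : R) (n k : ℕ) :
    binomMatrix z (n + 1) (k + 1) = binomMatrix z n k + z * binomMatrix z n (k + 1) := by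
  simp only [binomMatrix, of_apply, Nat.choose_succ_succ, Nat.add_sub_add_right, Nat.cast_add]
  rcases lt_or_ge k n with h | h
  · obtain ⟨d, rfl⟩ := Nat.exists_eq_add_of_lt h
    rw [show k + d + 1 - k = d + 1 by omega, show k + d + 1 - (k + 1) = d by omega, pow_succ]
    ring
  · rw [Nat.choose_eq_zero_of_lt (show n < k + 1 by omega)]
    simp

theorem binomMatrix_eq_pow (z : R) (N n : ℕ) (k : Fin (N + 1)) :
    binomMatrix z n k =
      (((shiftAdd z).submatrix Fin.val Fin.val : Matrix (Fin (N + 1)) (Fin (N + 1)) R) ^ n) 0 k := by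
  induction n generalizing k with
  | zero =>
    rcases Fin.eq_zero_or_eq_succ k with rfl | ⟨j, rfl⟩
    · simp [binomMatrix]
    · simp [binomMatrix, (Fin.succ_ne_zero j).symm]
  | succ n ih =>
    rw [pow_succ, Matrix.mul_apply, ← Finset.sum_congr rfl fun j _ => by rw [← ih j]]
    rcases Fin.eq_zero_or_eq_succ k with rfl | ⟨j, rfl⟩
    · rw [Finset.sum_eq_single 0]
      · simp [binomMatrix_succ_zero, shiftAdd, mul_comm]
      · intro b _ hb
        have : (b : ℕ) ≠ 0 := fun h => hb (Fin.ext h)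
        simp [shiftAdd, this.symm]
      · simp
    · rw [Finset.sum_eq_add j.castSucc j.succ (Fin.castSucc_lt_succ).ne]
      · simp [binomMatrix_succ_succ, shiftAdd, mul_comm]
      · intro b _ hb
        have h1 : (b : ℕ) ≠ j := fun h => hb.1 (Fin.ext h)
        have h2 : (b : ℕ) ≠ j + 1 := fun h => hb.2 (Fin.ext h)
        simp [shiftAdd, h1.symm, h2.symm]
      · simp
      · simp

theorem isTotallyPositive_binomMatrix {P : Subsemiring R} {z : R} (hz : z ∈ P) :
    (binomMatrix z).IsTotallyPositive P := by
  intro k f g hf hg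
  obtain ⟨N, hN⟩ : ∃ N, ∀ i, g i ≤ N := by
    obtain ⟨N, hN⟩ := (Set.finite_range g).bddAbove
    exact ⟨N, fun i => hN ⟨i, rfl⟩⟩
  have h := ((isTotallyPositive_shiftAdd hz).submatrix (Fin.val_strictMono (n := N + 1))
    (Fin.val_strictMono (n := N + 1))).output k f (fun i => ⟨g i, Nat.lt_succ_of_le (hN i)⟩) hf
    (fun a b hab => hg hab)
  convert h using 2
  ext a b
  exact binomMatrix_eq_pow z N (f a) ⟨g b, Nat.lt_succ_of_le (hN b)⟩

end Matrix

theorem iterate_mem_of_mapsTo {α : Type*} {p : α → α} {S : Finset α} (h : ∀ v ∈ S, p v ∈ S)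
    (m : ℕ) :
    ∀ v ∈ S, p^[m] v ∈ S := by
  induction m with
  | zero => exact fun v hv => hv
  | succ m ih => exact fun v hv => ih _ (h v hv)

theorem iterate_eq_of_eqOn {α : Type*} {p q : α → α} {S : Finset α} (h : ∀ v ∈ S, p v ∈ S)
    (hpq : ∀ v ∈ S, q v = p v) (m : ℕ) : ∀ v ∈ S, q^[m] v = p^[m] v := by
  induction m with
  | zero => exact fun v hv => rfl
  | succ m ih =>
    intro v hv
    rw [Function.iterate_succ_apply, Function.iterate_succ_apply, hpq v hv, ih _ (h v hv)]

/-- `p` is the parent function of a tree on the vertex set `S` with root `r`, extended by the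
identity outside `S`. -/
structure IsTreeOn {ι : Type*} (S : Finset ι) (r : ι) (p : ι → ι) : Prop where
  root_mem : r ∈ S
  root_fixed : p r = r
  mapsTo : ∀ v ∈ S, p v ∈ S
  reach : ∀ v ∈ S, ∃ m : ℕ, p^[m] v = r
  fixed : ∀ v ∉ S, p v = v

theorem IsTreeOn.child_unique {ι : Type*} {S : Finset ι} {r s a b : ι} {p : ι → ι}
    (hp : IsTreeOn S r p)
    (har : a ≠ r) (hpa : p a = r) (hbr : b ≠ r) (hpb : p b = r)
    (ha : ∃ m : ℕ, p^[m] s = a) (hb : ∃ m : ℕ, p^[m] s = b) : a = b := by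
  obtain ⟨m, hm⟩ := ha
  obtain ⟨k, hk⟩ := hb
  rcases lt_trichotomy m k with h | h | h
  · obtain ⟨d, rfl⟩ := Nat.exists_eq_add_of_lt h
    rw [show m + d + 1 = d + 1 + m by omega, Function.iterate_add_apply, hm,
      Function.iterate_succ_apply, hpa, Function.iterate_fixed hp.root_fixed] at hk
    exact absurd hk.symm hbr
  · rw [← hm, ← hk, h]
  · obtain ⟨d, rfl⟩ := Nat.exists_eq_add_of_lt h
    rw [show k + d + 1 = d + 1 + k by omega, Function.iterate_add_apply, hk,
      Function.iterate_succ_apply, hpb, Function.iterate_fixed hp.root_fixed] at hm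
    exact absurd hm.symm har

section TreesOn

variable {ι : Type*} [LinearOrder ι]

/-- Attach the tree `pA` on `A` with root `a` to the vertex `r` of the tree `pB`. -/
noncomputable def glueTree (A : Finset ι) (a : ι) (pA : ι → ι) (r : ι) (pB : ι → ι) (v : ι) : ι :=
  if v = a then r else if v ∈ A then pA v else pB v

section Glue

variable {A B : Finset ι} {a r : ι} {pA pB : ι → ι}

theorem glueTree_of_mem_right (hA : IsTreeOn A a pA) (hAB : Disjoint A B) {v : ι} (hv : v ∈ B) :
    glueTree A a pA r pB v = pB v := by
  have h : v ∉ A := fun h => Finset.disjoint_left.1 hAB h hv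
  have h' : v ≠ a := fun h' => h (h' ▸ hA.root_mem)
  simp [glueTree, h, h']

theorem glueTree_of_notMem (hA : IsTreeOn A a pA) (hB : IsTreeOn B r pB) {v : ι}
    (hvA : v ∉ A) (hvB : v ∉ B) : glueTree A a pA r pB v = v := by
  have h' : v ≠ a := fun h' => hvA (h' ▸ hA.root_mem)
  simp [glueTree, hvA, h', hB.fixed v hvB]

theorem glueTree_iterate_of_mem_right (hA : IsTreeOn A a pA) (hB : IsTreeOn B r pB)
    (hAB : Disjoint A B) (m : ℕ) {v : ι} (hv : v ∈ B) :
    (glueTree A a pA r pB)^[m] v = pB^[m] v :=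
  iterate_eq_of_eqOn hB.mapsTo (fun _ h => glueTree_of_mem_right hA hAB h) m v hv

theorem exists_glueTree_iterate (m : ℕ) (hA : IsTreeOn A a pA) {v j : ι} (hv : v ∈ A)
    (h : pA^[m] v = j) : ∃ m', (glueTree A a pA r pB)^[m'] v = j := by
  induction m generalizing v with
  | zero => exact ⟨0, h⟩
  | succ m ih =>
    by_cases hva : v = a
    · refine ⟨0, ?_⟩
      rw [← h, hva, Function.iterate_fixed hA.root_fixed]
      rfl
    · obtain ⟨m', hm'⟩ := ih (hA.mapsTo v hv) h
      refine ⟨m' + 1, ?_⟩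
      rw [Function.iterate_succ_apply, glueTree, if_neg hva, if_pos hv, hm']

theorem exists_iterate_of_glueTree (m : ℕ) (hA : IsTreeOn A a pA) (hB : IsTreeOn B r pB)
    (hAB : Disjoint A B) {v j : ι} (hv : v ∈ A) (hj : j ∈ A)
    (h : (glueTree A a pA r pB)^[m] v = j) : ∃ m', pA^[m'] v = j := by
  induction m generalizing v with
  | zero => exact ⟨0, h⟩
  | succ m ih =>
    by_cases hva : v = a
    · exfalso
      rw [Function.iterate_succ_apply, glueTree, if_pos hva,
        glueTree_iterate_of_mem_right hA hB hAB m hB.root_mem,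
        Function.iterate_fixed hB.root_fixed] at h
      exact Finset.disjoint_left.1 hAB hj (h ▸ hB.root_mem)
    · rw [Function.iterate_succ_apply, glueTree, if_neg hva, if_pos hv] at h
      obtain ⟨m', hm'⟩ := ih (hA.mapsTo v hv) h
      exact ⟨m' + 1, hm'⟩

theorem glueTree_desc_left (hA : IsTreeOn A a pA) (hB : IsTreeOn B r pB)
    (hAB : Disjoint A B) {d j : ι} (hj : j ∈ A) :
    (∃ m : ℕ, (glueTree A a pA r pB)^[m] d = j) ↔ ∃ m : ℕ, pA^[m] d = j := by
  by_cases hdA : d ∈ A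
  · exact ⟨fun ⟨m, h⟩ => exists_iterate_of_glueTree m hA hB hAB hdA hj h,
      fun ⟨m, h⟩ => exists_glueTree_iterate m hA hdA h⟩
  · refine iff_of_false ?_ ?_
    · rintro ⟨m, h⟩
      by_cases hdB : d ∈ B
      · rw [glueTree_iterate_of_mem_right hA hB hAB m hdB] at h
        exact Finset.disjoint_left.1 hAB hj (h ▸ iterate_mem_of_mapsTo hB.mapsTo m d hdB)
      · rw [Function.iterate_fixed (glueTree_of_notMem hA hB hdA hdB)] at h
        exact hdA (h ▸ hj)
    · rintro ⟨m, h⟩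
      rw [Function.iterate_fixed (hA.fixed d hdA)] at h
      exact hdA (h ▸ hj)

theorem glueTree_desc_root (hA : IsTreeOn A a pA) (hB : IsTreeOn B r pB)
    (hAB : Disjoint A B) {d : ι} :
    (∃ m : ℕ, (glueTree A a pA r pB)^[m] d = a) ↔ d ∈ A := by
  rw [glueTree_desc_left hA hB hAB hA.root_mem]
  refine ⟨fun ⟨m, h⟩ => ?_, hA.reach d⟩
  by_contra hdA
  rw [Function.iterate_fixed (hA.fixed d hdA)] at h
  exact hdA (h ▸ hA.root_mem)

theorem glueTree_reach_root (hA : IsTreeOn A a pA) (hB : IsTreeOn B r pB)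
    (hAB : Disjoint A B) {v : ι} (hv : v ∈ A) (m : ℕ) :
    (glueTree A a pA r pB)^[m] v ∈ A ∨ (glueTree A a pA r pB)^[m] v = r := by
  induction m with
  | zero => exact Or.inl hv
  | succ m ih =>
    rw [Function.iterate_succ_apply']
    rcases ih with h | h
    · by_cases ha : (glueTree A a pA r pB)^[m] v = a
      · exact Or.inr (by rw [glueTree, if_pos ha])
      · refine Or.inl ?_
        rw [glueTree, if_neg ha, if_pos h]
        exact hA.mapsTo _ h
    · rw [h, glueTree_of_mem_right hA hAB hB.root_mem, hB.root_fixed]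
      exact Or.inr rfl

theorem glueTree_desc_right (hA : IsTreeOn A a pA) (hB : IsTreeOn B r pB)
    (hAB : Disjoint A B) {d j : ι} (hj : j ∈ B) (hjr : j ≠ r) :
    (∃ m : ℕ, (glueTree A a pA r pB)^[m] d = j) ↔ ∃ m : ℕ, pB^[m] d = j := by
  by_cases hdB : d ∈ B
  · simp only [glueTree_iterate_of_mem_right hA hB hAB _ hdB]
  · refine iff_of_false ?_ ?_
    · rintro ⟨m, h⟩
      by_cases hdA : d ∈ A
      · rcases glueTree_reach_root hA hB hAB hdA m with h' | h'
        · exact Finset.disjoint_left.1 hAB (h ▸ h') hj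
        · exact hjr (h.symm.trans h')
      · rw [Function.iterate_fixed (glueTree_of_notMem hA hB hdA hdB)] at h
        exact hdB (h ▸ hj)
    · rintro ⟨m, h⟩
      rw [Function.iterate_fixed (hB.fixed d hdB)] at h
      exact hdB (h ▸ hj)

theorem IsTreeOn.glue (hA : IsTreeOn A a pA) (hB : IsTreeOn B r pB) (hAB : Disjoint A B)
    {S : Finset ι} (hS : A ∪ B = S) : IsTreeOn S r (glueTree A a pA r pB) := by
  subst hS
  have hroot := glueTree_of_mem_right (r := r) (pB := pB) hA hAB hB.root_mem
  have hreachB : ∀ v ∈ B, ∃ m : ℕ, (glueTree A a pA r pB)^[m] v = r := fun v hv => by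
    obtain ⟨m, hm⟩ := hB.reach v hv
    exact ⟨m, by rw [glueTree_iterate_of_mem_right hA hB hAB m hv, hm]⟩
  refine ⟨Finset.mem_union_right _ hB.root_mem, hroot.trans hB.root_fixed, ?_, ?_, ?_⟩
  · intro v hv
    rcases Finset.mem_union.1 hv with h | h
    · unfold glueTree
      split_ifs
      · exact Finset.mem_union_right _ hB.root_mem
      · exact Finset.mem_union_left _ (hA.mapsTo v h)
    · rw [glueTree_of_mem_right hA hAB h]
      exact Finset.mem_union_right _ (hB.mapsTo v h)
  · intro v hv
    rcases Finset.mem_union.1 hv with h | h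
    · obtain ⟨m, hm⟩ := (glueTree_desc_root (r := r) hA hB hAB).2 h
      refine ⟨m + 1, ?_⟩
      rw [Function.iterate_succ_apply', hm, glueTree, if_pos rfl]
    · exact hreachB v h
  · intro v hv
    rw [Finset.mem_union, not_or] at hv
    exact glueTree_of_notMem hA hB hv.1 hv.2

end Glue

/-- A vertex `s` other than the root descends from a unique child of the root. -/
theorem IsTreeOn.exists_child {S : Finset ι} {r s : ι} {p : ι → ι} (hp : IsTreeOn S r p)
    (hs : s ∈ S) (hsr : s ≠ r) :
    ∃ a ∈ S, a ≠ r ∧ p a = r ∧ ∃ m : ℕ, p^[m] s = a := by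
  obtain ⟨m, hm⟩ := hp.reach s hs
  induction m generalizing s with
  | zero => exact absurd hm hsr
  | succ m ih =>
    by_cases h : p s = r
    · exact ⟨s, hs, hsr, h, 0, rfl⟩
    · obtain ⟨a, ha, har, hpa, m', hm'⟩ := ih (hp.mapsTo s hs) h hm
      exact ⟨a, ha, har, hpa, m' + 1, hm'⟩

/-- Cutting the edge above a child `a` of the root. -/
theorem IsTreeOn.cut {S A : Finset ι} {r a : ι} {p : ι → ι} (hp : IsTreeOn S r p)
    (ha : a ∈ S) (har : a ≠ r) (hpa : p a = r) (hA : ∀ v, v ∈ A ↔ ∃ m : ℕ, p^[m] v = a) :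
    A ⊆ S ∧ r ∉ A ∧ IsTreeOn A a (fun v => if v ∈ A ∧ v ≠ a then p v else v) ∧
      IsTreeOn (S \ A) r (fun v => if v ∈ A then v else p v) ∧
      glueTree A a (fun v => if v ∈ A ∧ v ≠ a then p v else v) r
        (fun v => if v ∈ A then v else p v) = p := by
  have haA : a ∈ A := (hA a).2 ⟨0, rfl⟩
  have hAS : A ⊆ S := by
    intro v hv
    by_contra hvS
    obtain ⟨m, hm⟩ := (hA v).1 hv
    rw [Function.iterate_fixed (hp.fixed v hvS)] at hm
    exact hvS (hm ▸ ha)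
  have hrA : r ∉ A := by
    intro h
    obtain ⟨m, hm⟩ := (hA r).1 h
    exact har (hm.symm.trans (Function.iterate_fixed hp.root_fixed m))
  have hstep : ∀ v ∈ A, v ≠ a → p v ∈ A := by
    intro v hv hva
    obtain ⟨m, hm⟩ := (hA v).1 hv
    cases m with
    | zero => exact absurd hm hva
    | succ m => exact (hA _).2 ⟨m, hm⟩
  have hback : ∀ v, p v ∈ A → v ∈ A := by
    intro v hv
    obtain ⟨m, hm⟩ := (hA _).1 hv
    exact (hA v).2 ⟨m + 1, hm⟩
  refine ⟨hAS, hrA, ⟨haA, by simp, ?_, ?_, ?_⟩, ⟨?_, ?_, ?_, ?_, ?_⟩, ?_⟩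
  · intro v hv
    by_cases hva : v = a
    · simpa [hva] using haA
    · simpa [hva, hv] using hstep v hv hva
  · intro v hv
    obtain ⟨m, hm⟩ := (hA v).1 hv
    induction m generalizing v with
    | zero => exact ⟨0, hm⟩
    | succ m ih =>
      by_cases hva : v = a
      · exact ⟨0, hva⟩
      · obtain ⟨m', hm'⟩ := ih (p v) (hstep v hv hva) hm
        refine ⟨m' + 1, ?_⟩
        rw [Function.iterate_succ_apply, if_pos ⟨hv, hva⟩, hm']
  · intro v hv
    simp [hv]
  · exact Finset.mem_sdiff.2 ⟨hp.root_mem, hrA⟩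
  · simp [hrA, hp.root_fixed]
  · intro v hv
    rw [Finset.mem_sdiff] at hv ⊢
    simp only [hv.2, if_false]
    exact ⟨hp.mapsTo v hv.1, fun h => hv.2 (hback v h)⟩
  · intro v hv
    rw [Finset.mem_sdiff] at hv
    obtain ⟨m, hm⟩ := hp.reach v hv.1
    have : ∀ m v, v ∉ A → (fun v => if v ∈ A then v else p v)^[m] v = p^[m] v := by
      intro m
      induction m with
      | zero => exact fun v _ => rfl
      | succ m ih =>
        intro v hv
        simp only [Function.iterate_succ_apply, hv, if_false]
        exact ih _ fun h => hv (hback v h)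
    exact ⟨m, by rw [this m v hv.2, hm]⟩
  · intro v hv
    by_cases hvA : v ∈ A
    · simp [hvA]
    · simp only [hvA, if_false]
      exact hp.fixed v fun h => hv (Finset.mem_sdiff.2 ⟨h, hvA⟩)
  · funext v
    unfold glueTree
    by_cases hva : v = a
    · simp [hva, hpa]
    · by_cases hvA : v ∈ A <;> simp [hva, hvA]

variable {K : Type*} [CommRing K]

/-- The weight of the edge above `j`: `y` if it is improper, and `c i` if it is a proper edge
below the vertex `i`. -/
noncomputable def edgeWeight (y : K) (c : ι → K) (p : ι → ι) (j : ι) : K :=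
  if ∃ d, (∃ m : ℕ, p^[m] d = j) ∧ d < p j then y else c (p j)

/-- The weighted count of trees on `S` with root `r`. -/
noncomputable def treeSum [Fintype ι] (y : K) (c : ι → K) (S : Finset ι) (r : ι) : K :=
  ∑ p : ι → ι with IsTreeOn S r p, ∏ j ∈ S.erase r, edgeWeight y c p j

theorem prod_edgeWeight_glueTree {A B S : Finset ι} {a r : ι} {pA pB : ι → ι} (y : K) (c : ι → K)
    (hA : IsTreeOn A a pA) (hB : IsTreeOn B r pB) (hAB : Disjoint A B) (hS : A ∪ B = S) :
    ∏ j ∈ S.erase r, edgeWeight y c (glueTree A a pA r pB) j =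
      (∏ j ∈ A.erase a, edgeWeight y c pA j) * (∏ j ∈ B.erase r, edgeWeight y c pB j) *
        (if ∃ d ∈ A, d < r then y else c r) := by
  have hrA : r ∉ A := fun h => Finset.disjoint_left.1 hAB h hB.root_mem
  have hSr : S.erase r = A ∪ B.erase r := by
    rw [← hS, Finset.erase_union_distrib, Finset.erase_eq_of_notMem hrA]
  rw [hSr, Finset.prod_union (hAB.mono_right (Finset.erase_subset _ _)),
    ← Finset.mul_prod_erase A _ hA.root_mem]
  have h1 : edgeWeight y c (glueTree A a pA r pB) a = if ∃ d ∈ A, d < r then y else c r := by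
    have : glueTree A a pA r pB a = r := by rw [glueTree, if_pos rfl]
    simp only [edgeWeight, glueTree_desc_root hA hB hAB, this]
  have h2 : ∏ j ∈ A.erase a, edgeWeight y c (glueTree A a pA r pB) j =
      ∏ j ∈ A.erase a, edgeWeight y c pA j := by
    refine Finset.prod_congr rfl fun j hj => ?_
    rw [Finset.mem_erase] at hj
    have : glueTree A a pA r pB j = pA j := by rw [glueTree, if_neg hj.1, if_pos hj.2]
    simp only [edgeWeight, glueTree_desc_left hA hB hAB hj.2, this]
  have h3 : ∏ j ∈ B.erase r, edgeWeight y c (glueTree A a pA r pB) j =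
      ∏ j ∈ B.erase r, edgeWeight y c pB j := by
    refine Finset.prod_congr rfl fun j hj => ?_
    rw [Finset.mem_erase] at hj
    simp only [edgeWeight, glueTree_desc_right hA hB hAB hj.2 hj.1,
      glueTree_of_mem_right hA hAB hj.2]
  rw [h1, h2, h3]
  ring

/-- Decomposition of a tree with respect to the child of the root from which `s` descends. -/
theorem treeSum_eq_sum_cut [Fintype ι] (y : K) (c : ι → K) {S : Finset ι} {r s : ι}
    (hs : s ∈ S) (hsr : s ≠ r) :
    treeSum y c S r = ∑ A ∈ S.powerset with s ∈ A ∧ r ∉ A,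
      (∑ a ∈ A, treeSum y c A a) * treeSum y c (S \ A) r *
        (if ∃ d ∈ A, d < r then y else c r) := by
  have hsplit : ∀ A : Finset ι, (∑ a ∈ A, treeSum y c A a) * treeSum y c (S \ A) r *
        (if ∃ d ∈ A, d < r then y else c r) =
      ∑ a ∈ A, ∑ pA : ι → ι with IsTreeOn A a pA, ∑ pB : ι → ι with IsTreeOn (S \ A) r pB,
        (∏ j ∈ A.erase a, edgeWeight y c pA j) * (∏ j ∈ (S \ A).erase r, edgeWeight y c pB j) *
          (if ∃ d ∈ A, d < r then y else c r) := by
    intro A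
    rw [Finset.sum_mul, Finset.sum_mul]
    refine Finset.sum_congr rfl fun a _ => ?_
    simp only [treeSum, Finset.sum_mul, Finset.mul_sum]
    exact Finset.sum_comm
  rw [Finset.sum_congr rfl fun A _ => hsplit A]
  simp only [Finset.sum_sigma']
  rw [treeSum, eq_comm]
  refine Finset.sum_bij (fun q _ => glueTree q.1 q.2.1 q.2.2.1 r q.2.2.2) ?_ ?_ ?_ ?_
  · rintro ⟨A, a, pA, pB⟩ hq
    simp only [Finset.mem_sigma, Finset.mem_filter, Finset.mem_powerset, Finset.mem_univ,
      true_and] at hq ⊢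
    obtain ⟨⟨hAS, -, -⟩, -, hA, hB⟩ := hq
    exact hA.glue hB Finset.disjoint_sdiff (Finset.union_sdiff_of_subset hAS)
  · rintro ⟨A, a, pA, pB⟩ hq ⟨A', a', pA', pB'⟩ hq' h
    simp only [Finset.mem_sigma, Finset.mem_filter, Finset.mem_powerset, Finset.mem_univ,
      true_and] at hq hq' h
    obtain ⟨⟨hAS, hsA, hrA⟩, -, hA, hB⟩ := hq
    obtain ⟨⟨hAS', hsA', hrA'⟩, -, hA', hB'⟩ := hq'
    have hT := hA.glue hB Finset.disjoint_sdiff (Finset.union_sdiff_of_subset hAS)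
    have haa : a = a' := by
      refine hT.child_unique (s := s) (fun h => hrA (h ▸ hA.root_mem)) (by rw [glueTree, if_pos rfl])
        (fun h => hrA' (h ▸ hA'.root_mem)) (by rw [h, glueTree, if_pos rfl])
        ((glueTree_desc_root hA hB Finset.disjoint_sdiff).2 hsA) ?_
      rw [h]
      exact (glueTree_desc_root hA' hB' Finset.disjoint_sdiff).2 hsA'
    subst haa
    have hAA : A = A' := by
      ext v
      rw [← glueTree_desc_root hA hB Finset.disjoint_sdiff, h,
        glueTree_desc_root hA' hB' Finset.disjoint_sdiff]
    subst hAA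
    have hpA : pA = pA' := by
      funext v
      by_cases hva : v = a
      · rw [hva, hA.root_fixed, hA'.root_fixed]
      · by_cases hv : v ∈ A
        · simpa [glueTree, hva, hv] using congrFun h v
        · rw [hA.fixed v hv, hA'.fixed v hv]
    have hpB : pB = pB' := by
      funext v
      by_cases hv : v ∈ A
      · have : v ∉ S \ A := by simp [hv]
        rw [hB.fixed v this, hB'.fixed v this]
      · have hva : v ≠ a := fun h => hv (h ▸ hA.root_mem)
        simpa [glueTree, hva, hv] using congrFun h v
    rw [hpA, hpB]
  · intro p hp
    simp only [Finset.mem_filter, Finset.mem_univ, true_and] at hp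
    obtain ⟨a, ha, har, hpa, hsa⟩ := hp.exists_child hs hsr
    have hAmem : ∀ v, v ∈ Finset.univ.filter (fun v => ∃ m : ℕ, p^[m] v = a) ↔
        ∃ m : ℕ, p^[m] v = a := by simp
    obtain ⟨hAS, hrA, hA, hB, hglue⟩ := hp.cut ha har hpa hAmem
    refine ⟨⟨_, a, _, _⟩, ?_, hglue⟩
    simp only [Finset.mem_sigma, Finset.mem_filter, Finset.mem_powerset, Finset.mem_univ, true_and]
    exact ⟨⟨hAS, (hAmem s).2 hsa, hrA⟩, (hAmem a).2 ⟨0, rfl⟩, hA, hB⟩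
  · rintro ⟨A, a, pA, pB⟩ hq
    simp only [Finset.mem_sigma, Finset.mem_filter, Finset.mem_powerset, Finset.mem_univ,
      true_and] at hq
    obtain ⟨⟨hAS, -, -⟩, -, hA, hB⟩ := hq
    exact (prod_edgeWeight_glueTree y c hA hB Finset.disjoint_sdiff
      (Finset.union_sdiff_of_subset hAS)).symm

end TreesOn

mutual

/-- Weighted count of trees on `n + 1` vertices rooted at the smallest vertex, with weight `y` for
improper edges, `x` for edges below the smallest vertex, and `z` for the other proper edges. -/
noncomputable def minRootedSeq {K : Type*} [CommRing K] (y z x : K) : ℕ → K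
  | 0 => 1
  | n + 1 => x * ∑ j : Fin (n + 1),
      (n.choose j : K) * (treeSeq y z z j * minRootedSeq y z x (n - j))
termination_by n => (n, 0)
decreasing_by
  all_goals omega

/-- Weighted count of rooted trees on `n + 1` vertices, with weight `y` for improper edges, `x` for
edges below the smallest vertex, and `z` for the other proper edges. -/
noncomputable def treeSeq {K : Type*} [CommRing K] (y z x : K) (n : ℕ) : K :=
  minRootedSeq y z x n + y * ∑ j : Fin n,
    (n.choose j : K) * (treeSeq y z x j * treeSeq y z z (n - 1 - j))
termination_by (n, 1)
decreasing_by
  all_goals omega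

end

theorem Finset.sum_powerset_filter_mem {ι K : Type*} [LinearOrder ι] [CommRing K] {U : Finset ι}
    {s : ι} {n : ℕ} (hs : s ∈ U) (hU : U.card = n + 1) (g : ℕ → K) :
    ∑ A ∈ U.powerset with s ∈ A, g A.card =
      ∑ j ∈ Finset.range (n + 1), (n.choose j : K) * g (j + 1) := by
  have hcard : (U.erase s).card = n := by rw [Finset.card_erase_of_mem hs, hU]; rfl
  have h := Finset.sum_powerset_apply_card (f := fun j => g (j + 1)) (x := U.erase s)
  rw [hcard] at h
  simp only [nsmul_eq_mul] at h
  rw [← h, eq_comm]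
  refine Finset.sum_bij' (fun A _ => insert s A) (fun A _ => A.erase s) ?_ ?_ ?_ ?_ ?_
  · intro A hA
    rw [Finset.mem_powerset] at hA
    simp only [Finset.mem_filter, Finset.mem_powerset, Finset.mem_insert_self, and_true]
    exact Finset.insert_subset hs (hA.trans (Finset.erase_subset _ _))
  · intro A hA
    simp only [Finset.mem_filter, Finset.mem_powerset] at hA ⊢
    exact Finset.erase_subset_erase _ hA.1
  · intro A hA
    rw [Finset.mem_powerset] at hA
    exact Finset.erase_insert fun h => Finset.notMem_erase s U (hA h)
  · intro A hA
    exact Finset.insert_erase (Finset.mem_filter.1 hA).2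
  · intro A hA
    rw [Finset.mem_powerset] at hA
    rw [Finset.card_insert_of_notMem fun h => Finset.notMem_erase s U (hA h)]

section TreeCounts

variable {ι K : Type*} [LinearOrder ι] [Fintype ι] [CommRing K]

theorem treeSum_singleton (y : K) (c : ι → K) (r : ι) : treeSum y c {r} r = 1 := by
  have : (Finset.univ.filter fun p : ι → ι => IsTreeOn {r} r p) = {id} := by
    ext p
    simp only [Finset.mem_filter, Finset.mem_univ, true_and, Finset.mem_singleton]
    constructor
    · intro h
      funext v
      by_cases hv : v = r
      · rw [hv, h.root_fixed]; rfl
      · exact h.fixed v (by simpa using hv)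
    · rintro rfl
      exact ⟨by simp, rfl, fun _ h => h, fun v hv => ⟨0, by simpa using hv⟩, fun _ _ => rfl⟩
  rw [treeSum, this]
  simp

theorem treeSum_eq_seq (y z : K) (c : ι → K) (n : ℕ) : ∀ (S : Finset ι) (μ : ι), μ ∈ S →
    (∀ v ∈ S, μ ≤ v) → (∀ v ∈ S, v ≠ μ → c v = z) → S.card = n + 1 →
    treeSum y c S μ = minRootedSeq y z (c μ) n ∧
      ∑ a ∈ S, treeSum y c S a = treeSeq y z (c μ) n := by
  induction n using Nat.strong_induction_on with
  | _ n ih =>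
  intro S μ hμ hmin hc hS
  have hright : ∀ A ⊆ S, μ ∉ A → A.Nonempty →
      ∑ a ∈ A, treeSum y c A a = treeSeq y z z (A.card - 1) := by
    intro A hAS hμA hA
    have hlt : A.card < S.card := Finset.card_lt_card
      ((Finset.ssubset_iff_of_subset hAS).2 ⟨μ, hμ, hμA⟩)
    have hpos := hA.card_pos
    have hm := A.min'_mem hA
    have h := (ih (A.card - 1) (by omega) A (A.min' hA) hm (fun v hv => A.min'_le v hv)
      (fun v hv _ => hc v (hAS hv) fun h => hμA (h ▸ hv)) (by omega)).2
    rwa [hc _ (hAS hm) fun h => hμA (h ▸ hm)] at h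
  have hleft : ∀ A ⊆ S, μ ∈ A → A ≠ S →
      treeSum y c A μ = minRootedSeq y z (c μ) (A.card - 1) ∧
        ∑ a ∈ A, treeSum y c A a = treeSeq y z (c μ) (A.card - 1) := by
    intro A hAS hμA hA
    have hlt : A.card < S.card := Finset.card_lt_card (hAS.ssubset_of_ne hA)
    have hpos := Finset.card_pos.2 ⟨μ, hμA⟩
    exact ih (A.card - 1) (by omega) A μ hμA (fun v hv => hmin v (hAS hv))
      (fun v hv => hc v (hAS hv)) (by omega)
  have hE : treeSum y c S μ = minRootedSeq y z (c μ) n := by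
    cases n with
    | zero =>
      obtain ⟨a, rfl⟩ := Finset.card_eq_one.1 hS
      rw [Finset.mem_singleton.1 hμ, treeSum_singleton, minRootedSeq]
    | succ n =>
      have hSμ : (S.erase μ).card = n + 1 := by rw [Finset.card_erase_of_mem hμ, hS]; rfl
      obtain ⟨s, hs⟩ := Finset.card_pos.1 (by omega : 0 < (S.erase μ).card)
      rw [Finset.mem_erase] at hs
      rw [treeSum_eq_sum_cut y c hs.2 hs.1]
      have hfilter : (S.powerset.filter fun A => s ∈ A ∧ μ ∉ A) =
          (S.erase μ).powerset.filter fun A => s ∈ A := by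
        ext A
        simp only [Finset.mem_filter, Finset.mem_powerset, Finset.subset_erase]
        tauto
      obtain ⟨g, hg⟩ : ∃ g : ℕ → K, ∀ k, g k =
          c μ * (treeSeq y z z (k - 1) * minRootedSeq y z (c μ) (n + 1 - k)) := ⟨_, fun _ => rfl⟩
      have hterm : ∀ A ∈ (S.erase μ).powerset.filter (fun A => s ∈ A),
          (∑ a ∈ A, treeSum y c A a) * treeSum y c (S \ A) μ *
            (if ∃ d ∈ A, d < μ then y else c μ) =
          g A.card := by
        intro A hA
        rw [hg]
        simp only [Finset.mem_filter, Finset.mem_powerset, Finset.subset_erase] at hA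
        obtain ⟨⟨hAS, hμA⟩, hsA⟩ := hA
        rw [hright A hAS hμA ⟨s, hsA⟩, if_neg, (hleft (S \ A) Finset.sdiff_subset
          (Finset.mem_sdiff.2 ⟨hμ, hμA⟩) fun h => by
            rw [← h, Finset.mem_sdiff] at hs; exact hs.2.2 hsA).1,
          Finset.card_sdiff_of_subset hAS, hS, show n + 1 + 1 - A.card - 1 = n + 1 - A.card by omega]
        · ring
        · rintro ⟨d, hd, hlt⟩
          exact absurd (hmin d (hAS hd)) (not_le.2 hlt)
      rw [hfilter, Finset.sum_congr rfl hterm,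
        Finset.sum_powerset_filter_mem (Finset.mem_erase.2 hs) hSμ, minRootedSeq,
        Fin.sum_univ_eq_sum_range (fun j => (n.choose j : K) *
          (treeSeq y z z j * minRootedSeq y z (c μ) (n - j))), Finset.mul_sum]
      refine Finset.sum_congr rfl fun j _ => ?_
      simp only [hg, Nat.add_sub_cancel, Nat.add_sub_add_right]
      ring
  refine ⟨hE, ?_⟩
  rw [← Finset.add_sum_erase S _ hμ, hE, treeSeq]
  congr 1
  have hcut : ∀ r ∈ S.erase μ, treeSum y c S r =
      ∑ A ∈ S.powerset with μ ∈ A ∧ r ∉ A,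
        y * ((∑ a ∈ A, treeSum y c A a) * treeSum y c (S \ A) r) := by
    intro r hr
    rw [Finset.mem_erase] at hr
    rw [treeSum_eq_sum_cut y c hμ hr.1.symm]
    refine Finset.sum_congr rfl fun A hA => ?_
    rw [if_pos ⟨μ, (Finset.mem_filter.1 hA).2.1, (hmin r hr.2).lt_of_ne hr.1.symm⟩]
    ring
  rw [Finset.sum_congr rfl hcut, Finset.sum_comm' (t' := S.powerset.filter fun A => μ ∈ A)
    (s' := fun A => S \ A)]
  · obtain ⟨g, hg⟩ : ∃ g : ℕ → K, ∀ k, g k = if k - 1 < n then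
        y * (treeSeq y z (c μ) (k - 1) * treeSeq y z z (n - k)) else 0 := ⟨_, fun _ => rfl⟩
    have hterm : ∀ A ∈ S.powerset.filter (fun A => μ ∈ A),
        ∑ r ∈ S \ A, y * ((∑ a ∈ A, treeSum y c A a) * treeSum y c (S \ A) r) =
        g A.card := by
      intro A hA
      rw [hg]
      simp only [Finset.mem_filter, Finset.mem_powerset] at hA
      by_cases hAS : A = S
      · subst hAS
        simp [hS]
      · have hlt : A.card < S.card := Finset.card_lt_card (hA.1.ssubset_of_ne hAS)
        have hpos := Finset.card_pos.2 ⟨μ, hA.2⟩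
        have hne : (S \ A).Nonempty := Finset.sdiff_nonempty.2 fun h => hAS (hA.1.antisymm h)
        rw [← Finset.mul_sum, ← Finset.mul_sum, (hleft A hA.1 hA.2 hAS).2,
          hright (S \ A) Finset.sdiff_subset (by simp [hA.2]) hne,
          Finset.card_sdiff_of_subset hA.1, hS]
        rw [if_pos (by omega), show n + 1 - A.card - 1 = n - A.card by omega]
    rw [Finset.sum_congr rfl hterm, Finset.sum_powerset_filter_mem hμ hS, Finset.sum_range_succ,
      Fin.sum_univ_eq_sum_range (fun j => (n.choose j : K) *
        (treeSeq y z (c μ) j * treeSeq y z z (n - 1 - j))), Finset.mul_sum]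
    simp only [hg, Nat.add_sub_cancel, lt_irrefl, if_false, mul_zero, add_zero]
    refine Finset.sum_congr rfl fun j hj => ?_
    rw [if_pos (Finset.mem_range.1 hj), show n - (j + 1) = n - 1 - j by omega]
    ring
  · intro r A
    simp only [Finset.mem_erase, Finset.mem_filter, Finset.mem_powerset, Finset.mem_sdiff]
    constructor
    · rintro ⟨⟨h1, h2⟩, h3, h4, h5⟩
      exact ⟨⟨h2, h5⟩, h3, h4⟩
    · rintro ⟨⟨h2, h5⟩, h3, h4⟩
      exact ⟨⟨fun h => h5 (h ▸ h4), h2⟩, h3, h4, h5⟩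

end TreeCounts

section Frozen

variable {K : Type*} [CommRing K]

theorem isTreeOn_univ_iff {n : ℕ} (T : Fin n × (Fin n → Fin n)) :
    IsTreeOn Finset.univ T.1 T.2 ↔ IsRootedTree T :=
  ⟨fun h => ⟨h.root_fixed, fun v => h.reach v (Finset.mem_univ v)⟩,
    fun h => ⟨Finset.mem_univ _, h.1, fun _ _ => Finset.mem_univ _, fun v _ => h.2 v,
      fun v hv => absurd (Finset.mem_univ v) hv⟩⟩

theorem prod_edgeWeight_eq (x y z : K) {n : ℕ} (T : Fin (n + 1) × (Fin (n + 1) → Fin (n + 1))) :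
    ∏ j ∈ Finset.univ.erase T.1, edgeWeight y (fun i => if i = 0 then x else z) T.2 j =
      y ^ imprope T * z ^ (prope T - childCount T 0) * x ^ childCount T 0 := by
  have hchild : childCount T 0 = ((Finset.univ.filter fun j =>
      j ≠ T.1 ∧ ¬ ImproperEdge T j).filter fun j => T.2 j = 0).card := by
    rw [childCount, Finset.filter_filter]
    congr 1
    ext j
    simp only [Finset.mem_filter, Finset.mem_univ, true_and]
    constructor
    · rintro ⟨h1, h2⟩
      refine ⟨⟨h1, ?_⟩, h2⟩
      rintro ⟨d, -, hd⟩
      rw [h2] at hd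
      exact absurd hd (Fin.not_lt_zero d)
    · rintro ⟨⟨h1, -⟩, h2⟩
      exact ⟨h1, h2⟩
  have hprope : prope T - childCount T 0 = ((Finset.univ.filter fun j =>
      j ≠ T.1 ∧ ¬ ImproperEdge T j).filter fun j => ¬ T.2 j = 0).card := by
    have := Finset.card_filter_add_card_filter_not (s := Finset.univ.filter fun j =>
      j ≠ T.1 ∧ ¬ ImproperEdge T j) (fun j => T.2 j = 0)
    rw [hchild, prope]
    omega
  have hset : (Finset.univ.erase T.1) = Finset.univ.filter fun j => j ≠ T.1 := by
    ext j; simp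
  have hw : ∀ j, edgeWeight y (fun i => if i = 0 then x else z) T.2 j =
      if ImproperEdge T j then y else if T.2 j = 0 then x else z := fun j => by
    simp only [edgeWeight, ImproperEdge, Descends]
    congr
  rw [hprope, hchild, imprope, hset, Finset.prod_congr rfl fun j _ => hw j, Finset.prod_ite,
    Finset.prod_const, Finset.filter_filter, Finset.filter_filter, Finset.prod_ite,
    Finset.prod_const, Finset.prod_const]
  ring

theorem childCount_le {n : ℕ} (T : Fin (n + 1) × (Fin (n + 1) → Fin (n + 1)))
    (i : Fin (n + 1)) : childCount T i ≤ n := by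
  have : childCount T i ≤ (Finset.univ.erase T.1).card :=
    Finset.card_le_card fun j hj => by simpa using (Finset.mem_filter.1 hj).2.1
  simpa using this

theorem TnXYZ_eq_treeSeq (n : ℕ) :
    TnXYZ n = treeSeq (MvPolynomial.X 1) (MvPolynomial.X 2) (MvPolynomial.X 0) n := by
  have h := (treeSum_eq_seq (K := MvPolynomial (Fin 3) ℤ) (MvPolynomial.X 1) (MvPolynomial.X 2)
    (fun i : Fin (n + 1) => if i = 0 then MvPolynomial.X 0 else MvPolynomial.X 2) n Finset.univ 0
    (Finset.mem_univ _) (fun v _ => Fin.zero_le v) (fun v _ hv => if_neg hv) (by simp)).2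
  rw [if_pos rfl] at h
  rw [← h]
  have hT : TnXYZ n = ∑ T ∈ rootedTrees (n + 1), (MvPolynomial.X 1) ^ imprope T *
      (MvPolynomial.X 2) ^ (prope T - childCount T 0) * (MvPolynomial.X 0) ^ childCount T 0 := by
    rw [← Finset.sum_fiberwise_of_maps_to (g := fun T => childCount T 0)
      (t := Finset.range (n + 1)) fun T _ =>
        Finset.mem_range.2 (Nat.lt_succ_of_le (childCount_le T 0))]
    refine Finset.sum_congr rfl fun k _ => ?_
    rw [tnkYZ, Finset.sum_mul]
    refine Finset.sum_congr rfl fun T hT => ?_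
    rw [(Finset.mem_filter.1 hT).2]
  rw [hT, rootedTrees, Finset.sum_filter, Fintype.sum_prod_type]
  refine Finset.sum_congr rfl fun a _ => ?_
  rw [treeSum, Finset.sum_filter]
  refine Finset.sum_congr rfl fun p _ => ?_
  rw [← prod_edgeWeight_eq]
  simp only [← isTreeOn_univ_iff]

end Frozen

section ExponentialGeneratingFunction

open PowerSeries Nat

variable {K : Type*} [Field K]

/-- The exponential generating function of a sequence. -/
noncomputable def expGF (a : ℕ → K) : K⟦X⟧ :=
  PowerSeries.mk fun n => a n / (n ! : K)

theorem coeff_expGF (a : ℕ → K) (n : ℕ) : coeff n (expGF a) = a n / (n ! : K) :=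
  coeff_mk _ _

theorem constantCoeff_expGF (a : ℕ → K) : constantCoeff (expGF a) = a 0 := by
  rw [← coeff_zero_eq_constantCoeff_apply, coeff_expGF]
  simp

theorem expGF_add (a b : ℕ → K) : expGF a + expGF b = expGF fun n => a n + b n := by
  ext n; simp [coeff_expGF, add_div]

theorem C_mul_expGF (c : K) (a : ℕ → K) : C c * expGF a = expGF fun n => c * a n := by
  ext n; simp [coeff_expGF, mul_div_assoc]

variable [CharZero K]

theorem derivative_expGF (a : ℕ → K) :
    derivative K (expGF a) = expGF fun n => a (n + 1) := by
  ext n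
  have h1 : (n ! : K) ≠ 0 := Nat.cast_ne_zero.2 (Nat.factorial_ne_zero n)
  have h2 : (n + 1 : K) ≠ 0 := by exact_mod_cast Nat.succ_ne_zero n
  rw [coeff_derivative, coeff_expGF, coeff_expGF, Nat.factorial_succ]
  push_cast
  field_simp

theorem expGF_mul (a b : ℕ → K) :
    expGF a * expGF b =
      expGF fun n => ∑ j ∈ Finset.range (n + 1), (n.choose j : K) * (a j * b (n - j)) := by
  ext n
  rw [coeff_mul, Finset.Nat.sum_antidiagonal_eq_sum_range_succ
    (fun i j => coeff i (expGF a) * coeff j (expGF b)), coeff_expGF, Finset.sum_div]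
  refine Finset.sum_congr rfl fun j hj => ?_
  have hj : j ≤ n := Nat.lt_succ_iff.1 (Finset.mem_range.1 hj)
  have h (m : ℕ) : (m ! : K) ≠ 0 := Nat.cast_ne_zero.2 (Nat.factorial_ne_zero m)
  rw [coeff_expGF, coeff_expGF, Nat.cast_choose K hj]
  field_simp [h n, h j, h (n - j)]

theorem derivative_expGF_pow (c : K) :
    derivative K (expGF fun n => c ^ n) = C c * expGF fun n => c ^ n := by
  rw [derivative_expGF, C_mul_expGF]
  simp only [_root_.pow_succ']

theorem expGF_pow_mul_expGF_neg_pow (c : K) :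
    (expGF fun n => c ^ n) * (expGF fun n => (-c) ^ n) = 1 := by
  refine derivative.ext ?_ ?_
  · rw [Derivation.leibniz, derivative_one, derivative_expGF_pow, derivative_expGF_pow, map_neg,
      smul_eq_mul, smul_eq_mul]
    ring
  · rw [map_mul, constantCoeff_expGF, constantCoeff_expGF]
    simp

end ExponentialGeneratingFunction

/-- The action of the production matrix on sequences. -/
noncomputable def productionStep {K : Type*} [CommRing K] (y z x : K) (v : ℕ → K) (j : ℕ) : K :=
  ∑ i ∈ Finset.range (j + 1), Matrix.binomMatrix z j i *
    ∑ k ∈ Finset.range (i + 2), Matrix.shiftAdd x i k *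
      ∑ l ∈ Finset.range (k + 1), Matrix.geomMatrix y k l * v l

section TreeSeries

open PowerSeries Nat

variable {K : Type*} [Field K] (y z x : K)

/-- Exponential generating function of `treeSeq y z z n`, shifted to count trees by vertices. -/
noncomputable def treeGF : K⟦X⟧ :=
  expGF fun n => n.casesOn 0 (treeSeq y z z)

theorem constantCoeff_treeGF : constantCoeff (treeGF y z) = 0 :=
  constantCoeff_expGF _

theorem hasSubst_treeGF : HasSubst (treeGF y z) :=
  HasSubst.of_constantCoeff_zero' (constantCoeff_treeGF y z)

theorem constantCoeff_subst_treeGF (f : K⟦X⟧) :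
    constantCoeff (f.subst (treeGF y z)) = constantCoeff f := by
  have h := constantCoeff_subst_eq_zero (constantCoeff_treeGF y z) (f - C (constantCoeff f))
    (by simp)
  rw [subst_sub (hasSubst_treeGF y z), subst_C] at h
  change constantCoeff (f.subst (treeGF y z) - C (constantCoeff f)) = 0 at h
  rwa [map_sub, constantCoeff_C, sub_eq_zero] at h

theorem subst_C_mul_treeGF (c : K) (f : K⟦X⟧) :
    (C c * f).subst (treeGF y z) = C c * f.subst (treeGF y z) := by
  rw [subst_mul (hasSubst_treeGF y z), subst_C]
  rfl

theorem subst_one_treeGF : (1 : K⟦X⟧).subst (treeGF y z) = 1 := by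
  rw [← coe_substAlgHom (hasSubst_treeGF y z), map_one]

variable [CharZero K]

theorem derivative_treeGF : derivative K (treeGF y z) = expGF (treeSeq y z z) :=
  derivative_expGF _

theorem derivative_minRootedSeq :
    derivative K (expGF (minRootedSeq y z x)) =
      C x * expGF (treeSeq y z z) * expGF (minRootedSeq y z x) := by
  rw [derivative_expGF, mul_assoc, expGF_mul, C_mul_expGF]
  congr 1
  funext n
  rw [minRootedSeq, Finset.sum_range]

theorem one_sub_mul_expGF_treeSeq :
    (1 - C y * treeGF y z) * expGF (treeSeq y z x) = expGF (minRootedSeq y z x) := by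
  rw [sub_mul, one_mul, sub_eq_iff_eq_add, mul_assoc, mul_comm (treeGF y z), treeGF, expGF_mul,
    C_mul_expGF, expGF_add]
  congr 1
  funext n
  rw [treeSeq, Finset.sum_range_succ, Finset.sum_range]
  congr 2
  rw [add_eq_left.2 (by simp)]
  refine Finset.sum_congr rfl fun j _ => ?_
  obtain ⟨m, hm⟩ : ∃ m, n - (j : ℕ) = m + 1 := ⟨n - j - 1, by omega⟩
  rw [hm, show n - 1 - (j : ℕ) = m by omega]

theorem expGF_minRootedSeq_eq :
    expGF (minRootedSeq y z z) = (expGF fun n => z ^ n).subst (treeGF y z) := by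
  have hR := hasSubst_treeGF y z
  have h1 : expGF (minRootedSeq y z z) * (expGF fun n => (-z) ^ n).subst (treeGF y z) = 1 := by
    refine derivative.ext ?_ ?_
    · rw [Derivation.leibniz, derivative_subst hR, derivative_expGF_pow, derivative_minRootedSeq,
        derivative_treeGF, derivative_one, subst_C_mul_treeGF, map_neg, smul_eq_mul, smul_eq_mul]
      ring
    · rw [map_mul, constantCoeff_subst_treeGF, constantCoeff_expGF, constantCoeff_expGF]
      simp [minRootedSeq]
  have h2 : (expGF fun n => z ^ n).subst (treeGF y z) *
      (expGF fun n => (-z) ^ n).subst (treeGF y z) = 1 := by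
    rw [← subst_mul hR, expGF_pow_mul_expGF_neg_pow, subst_one_treeGF]
  exact mul_right_cancel₀ (right_ne_zero_of_mul_eq_one h1) (h1.trans h2.symm)

theorem one_sub_mul_expGF_geomMatrix (v : ℕ → K) :
    (1 - C y * X) * expGF (fun k => ∑ l ∈ Finset.range (k + 1), Matrix.geomMatrix y k l * v l) =
      expGF v := by
  have hfac (m : ℕ) : (m ! : K) ≠ 0 := Nat.cast_ne_zero.2 (Nat.factorial_ne_zero m)
  ext n
  rw [sub_mul, one_mul, map_sub, mul_assoc, coeff_C_mul]
  cases n with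
  | zero => simp [coeff_expGF, Matrix.geomMatrix]
  | succ n =>
    have hrec : ∑ l ∈ Finset.range (n + 2), Matrix.geomMatrix y (n + 1) l * v l =
        (n + 1) * y * (∑ l ∈ Finset.range (n + 1), Matrix.geomMatrix y n l * v l) + v (n + 1) := by
      rw [Finset.sum_range_succ, Finset.mul_sum]
      congr 1
      · refine Finset.sum_congr rfl fun l hl => ?_
        have hl : l ≤ n := Nat.lt_succ_iff.1 (Finset.mem_range.1 hl)
        simp only [Matrix.geomMatrix, Matrix.of_apply, if_pos hl, if_pos (hl.trans n.le_succ)]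
        rw [← Finset.insert_Ioc_right_eq_Ioc_add_one hl, Finset.prod_insert (by simp)]
        push_cast
        ring
      · simp [Matrix.geomMatrix]
    have hn : (n + 1 : K) ≠ 0 := by exact_mod_cast Nat.succ_ne_zero n
    rw [coeff_succ_X_mul, coeff_expGF, coeff_expGF, coeff_expGF, hrec, Nat.factorial_succ]
    push_cast
    field_simp [hfac n]
    ring

theorem expGF_productionStep (v : ℕ → K) :
    ∃ g : K⟦X⟧, (1 - C y * X) * g = expGF v ∧
      expGF (productionStep y z x v) = (expGF fun n => z ^ n) * (derivative K g + C x * g) := by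
  refine ⟨_, one_sub_mul_expGF_geomMatrix y v, ?_⟩
  rw [derivative_expGF, C_mul_expGF, expGF_add, mul_comm, expGF_mul]
  congr 1
  funext j
  refine Finset.sum_congr rfl fun i _ => ?_
  rw [Finset.sum_range_succ, Finset.sum_range_succ, Finset.sum_eq_zero]
  · simp [Matrix.binomMatrix, Matrix.shiftAdd]
    ring
  · intro k hk
    have := Finset.mem_range.1 hk
    simp only [Matrix.shiftAdd, Matrix.of_apply]
    rw [if_neg (by omega), if_neg (by omega), zero_mul]

theorem derivative_subst_mul_expGF (v : ℕ → K) :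
    derivative K ((expGF v).subst (treeGF y z) * expGF (treeSeq y z x)) =
      (expGF (productionStep y z x v)).subst (treeGF y z) * expGF (treeSeq y z x) := by
  obtain ⟨g, hg, hv⟩ := expGF_productionStep y z x v
  have hR := hasSubst_treeGF y z
  have hE : (expGF v).subst (treeGF y z) * expGF (treeSeq y z x) =
      g.subst (treeGF y z) * expGF (minRootedSeq y z x) := by
    rw [← hg, subst_mul hR, ← one_sub_mul_expGF_treeSeq, subst_sub hR, subst_C_mul_treeGF,
      subst_one_treeGF, subst_X hR]
    ring
  have hF := one_sub_mul_expGF_treeSeq y z z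
  rw [expGF_minRootedSeq_eq] at hF
  rw [hE, Derivation.leibniz, derivative_minRootedSeq, derivative_subst hR, derivative_treeGF, hv,
    subst_mul hR, ← hF, subst_add hR, subst_C_mul_treeGF, ← one_sub_mul_expGF_treeSeq, smul_eq_mul,
    smul_eq_mul]
  ring

theorem treeSeq_eq_iterate_productionStep (n : ℕ) :
    treeSeq y z x n = (productionStep y z x)^[n] (fun j => if j = 0 then 1 else 0) 0 := by
  have key (n : ℕ) (v : ℕ → K) :
      (derivative K)^[n] ((expGF v).subst (treeGF y z) * expGF (treeSeq y z x)) =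
        (expGF ((productionStep y z x)^[n] v)).subst (treeGF y z) * expGF (treeSeq y z x) := by
    induction n generalizing v with
    | zero => rfl
    | succ n ih => rw [Function.iterate_succ_apply, derivative_subst_mul_expGF, ih,
        Function.iterate_succ_apply]
  have hone : expGF (fun j => if j = 0 then (1 : K) else 0) = 1 := by
    ext n
    rw [coeff_expGF, coeff_one]
    split_ifs with h <;> simp [h]
  have hzero : treeSeq y z x 0 = 1 := by
    rw [treeSeq, minRootedSeq]
    simp
  have h := congrArg constantCoeff (key n fun j => if j = 0 then 1 else 0)
  rw [hone, subst_one_treeGF, one_mul, map_mul, constantCoeff_subst_treeGF, constantCoeff_expGF,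
    constantCoeff_expGF, constantCoeff_iterate_derivative, coeff_expGF, hzero, mul_one] at h
  rw [← h, mul_div_cancel₀ _ (Nat.cast_ne_zero.2 (Nat.factorial_ne_zero n))]

end TreeSeries

section ProductionMatrix

open MvPolynomial

variable {K : Type*} [CommRing K]

/-- The production matrix of `treeSeq y z x`, truncated to order `N + 1`. -/
noncomputable def truncProductionMatrix (y z x : K) (N : ℕ) :
    Matrix (Fin (N + 1)) (Fin (N + 1)) K :=
  (Matrix.binomMatrix z).submatrix Fin.val Fin.val *
    ((Matrix.shiftAdd x).submatrix Fin.val Fin.val *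
      (Matrix.geomMatrix y).submatrix Fin.val Fin.val)

theorem sum_fin_eq_sum_range_of_eq_zero {N m : ℕ} (hm : m ≤ N) (f : ℕ → K)
    (hf : ∀ i, m ≤ i → f i = 0) : ∑ i : Fin N, f i = ∑ i ∈ Finset.range m, f i := by
  rw [← Finset.sum_range]
  refine (Finset.sum_subset (Finset.range_mono hm) fun i _ hi => hf i ?_).symm
  simpa using hi

theorem truncProductionMatrix_mulVec (y z x : K) {N M : ℕ} (hM : M + 1 ≤ N) {v : ℕ → K}
    {w : Fin (N + 1) → K} (h : ∀ l : Fin (N + 1), (l : ℕ) ≤ M + 1 → w l = v l)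
    {j : Fin (N + 1)} (hj : (j : ℕ) ≤ M) :
    (truncProductionMatrix y z x N).mulVec w j = productionStep y z x v j := by
  have hgeom (k : Fin (N + 1)) (hk : (k : ℕ) ≤ M + 1) :
      ((Matrix.geomMatrix y).submatrix Fin.val Fin.val).mulVec w k =
        ∑ l ∈ Finset.range (k + 1), Matrix.geomMatrix y k l * v l := by
    rw [← sum_fin_eq_sum_range_of_eq_zero (N := N + 1) (by omega)
      (fun l => Matrix.geomMatrix y k l * v l)]
    · simp only [Matrix.mulVec, dotProduct, Matrix.submatrix_apply]
      refine Finset.sum_congr rfl fun l _ => ?_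
      by_cases hl : (l : ℕ) ≤ k
      · simp [h l (hl.trans hk)]
      · simp [Matrix.geomMatrix, hl]
    · intro l hl
      simp [Matrix.geomMatrix, show ¬ l ≤ k by omega]
  have hshift (i : Fin (N + 1)) (hi : (i : ℕ) ≤ M) :
      ((Matrix.shiftAdd x).submatrix (Fin.val (n := N + 1)) (Fin.val (n := N + 1))).mulVec
        (((Matrix.geomMatrix y).submatrix Fin.val Fin.val).mulVec w) i =
      ∑ k ∈ Finset.range (i + 2), Matrix.shiftAdd x i k *
        ∑ l ∈ Finset.range (k + 1), Matrix.geomMatrix y k l * v l := by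
    rw [← sum_fin_eq_sum_range_of_eq_zero (N := N + 1) (by omega) (fun k => Matrix.shiftAdd x i k *
        ∑ l ∈ Finset.range (k + 1), Matrix.geomMatrix y k l * v l)]
    · rw [Matrix.mulVec, dotProduct]
      refine Finset.sum_congr rfl fun k _ => ?_
      by_cases hk : (k : ℕ) ≤ i + 1
      · rw [hgeom k (by omega)]
        rfl
      · simp [Matrix.shiftAdd, show (k : ℕ) ≠ i by omega, show (k : ℕ) ≠ i + 1 by omega]
    · intro k hk
      simp [Matrix.shiftAdd, show k ≠ i by omega, show k ≠ i + 1 by omega]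
  rw [truncProductionMatrix, ← Matrix.mulVec_mulVec, ← Matrix.mulVec_mulVec, productionStep,
    ← sum_fin_eq_sum_range_of_eq_zero (N := N + 1) (by omega) (fun i => Matrix.binomMatrix z j i *
    ∑ k ∈ Finset.range (i + 2), Matrix.shiftAdd x i k *
      ∑ l ∈ Finset.range (k + 1), Matrix.geomMatrix y k l * v l)]
  · rw [Matrix.mulVec, dotProduct]
    refine Finset.sum_congr rfl fun i _ => ?_
    by_cases hi : (i : ℕ) ≤ j
    · rw [hshift i (by omega)]
      rfl
    · simp [Matrix.binomMatrix, Nat.choose_eq_zero_of_lt (not_le.1 hi)]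
  · intro i hi
    simp [Matrix.binomMatrix, Nat.choose_eq_zero_of_lt (show (j : ℕ) < i by omega)]

theorem truncProductionMatrix_pow_apply_zero (y z x : K) {N n : ℕ} {j : Fin (N + 1)}
    (hj : (j : ℕ) + n ≤ N) :
    (truncProductionMatrix y z x N ^ n) j 0 =
      (productionStep y z x)^[n] (fun j => if j = 0 then 1 else 0) j := by
  induction n generalizing j with
  | zero =>
    simp only [pow_zero, Matrix.one_apply, Fin.ext_iff, Fin.val_zero, Function.iterate_zero, id]
  | succ n ih =>
    have h := truncProductionMatrix_mulVec y z x (N := N) (M := N - (n + 1)) (by omega)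
      (w := fun l => (truncProductionMatrix y z x N ^ n) l 0)
      (fun l hl => ih (by omega)) (j := j) (by omega)
    rw [pow_succ', Function.iterate_succ_apply', ← h]
    rfl

theorem map_treeSeq_and_minRootedSeq {L : Type*} [CommRing L] (φ : K →+* L) (y z : K) (n : ℕ) :
    ∀ x, φ (treeSeq y z x n) = treeSeq (φ y) (φ z) (φ x) n ∧
      φ (minRootedSeq y z x n) = minRootedSeq (φ y) (φ z) (φ x) n := by
  induction n using Nat.strong_induction_on with
  | _ n ih =>
    intro x
    have hmin : φ (minRootedSeq y z x n) = minRootedSeq (φ y) (φ z) (φ x) n := by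
      cases n with
      | zero => simp [minRootedSeq]
      | succ n =>
        rw [minRootedSeq, minRootedSeq, map_mul, map_sum]
        congr 1
        refine Finset.sum_congr rfl fun j _ => ?_
        rw [map_mul, map_mul, map_natCast, (ih j j.2 z).1, (ih (n - j) (by omega) x).2]
    refine ⟨?_, hmin⟩
    rw [treeSeq, treeSeq, map_add, map_mul, map_sum, hmin]
    congr 2
    refine Finset.sum_congr rfl fun j _ => ?_
    rw [map_mul, map_mul, map_natCast, (ih j j.2 x).1, (ih (n - 1 - j) (by omega) z).1]

theorem map_truncProductionMatrix {L : Type*} [CommRing L] (φ : K →+* L) (y z x : K) (N : ℕ) :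
    φ.mapMatrix (truncProductionMatrix y z x N) =
      truncProductionMatrix (φ y) (φ z) (φ x) N := by
  rw [truncProductionMatrix, truncProductionMatrix, map_mul, map_mul]
  congr 1
  · ext i j
    simp [Matrix.binomMatrix]
  · congr 1 <;> ext i j
    · simp [Matrix.shiftAdd, apply_ite φ]
    · simp [Matrix.geomMatrix, apply_ite φ]

theorem treeSeq_eq_truncProductionMatrix_pow [IsDomain K] [CharZero K] (y z x : K) {N n : ℕ}
    (hn : n ≤ N) : treeSeq y z x n = (truncProductionMatrix y z x N ^ n) 0 0 := by
  have : CharZero (FractionRing K) :=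
    charZero_of_injective_algebraMap (IsFractionRing.injective K (FractionRing K))
  refine IsFractionRing.injective K (FractionRing K) ?_
  rw [(map_treeSeq_and_minRootedSeq (algebraMap K (FractionRing K)) y z n x).1,
    treeSeq_eq_iterate_productionStep]
  have h := truncProductionMatrix_pow_apply_zero (algebraMap K (FractionRing K) y)
    (algebraMap K (FractionRing K) z) (algebraMap K (FractionRing K) x) (N := N) (n := n) (j := 0) (by simpa)
  rw [← map_truncProductionMatrix, ← map_pow] at h
  exact h.symm

/-- The polynomials with nonnegative coefficients. -/
def MvPolynomial.nonnegCoeffs (σ : Type*) : Subsemiring (MvPolynomial σ ℤ) where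
  carrier := {p | ∀ m, 0 ≤ p.coeff m}
  zero_mem' m := by simp
  one_mem' m := by
    rw [coeff_one]
    split_ifs <;> simp
  add_mem' hp hq m := by
    rw [coeff_add]
    exact add_nonneg (hp m) (hq m)
  mul_mem' hp hq m := by
    rw [coeff_mul]
    exact Finset.sum_nonneg fun a _ => mul_nonneg (hp _) (hq _)

theorem MvPolynomial.X_mem_nonnegCoeffs {σ : Type*} (i : σ) : X i ∈ nonnegCoeffs σ := fun m => by
  rw [coeff_X]
  split_ifs <;> simp

theorem isTotallyPositive_truncProductionMatrix {P : Subsemiring K} {y z x : K} (hy : y ∈ P)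
    (hz : z ∈ P) (hx : x ∈ P) (N : ℕ) : (truncProductionMatrix y z x N).IsTotallyPositive P :=
  ((Matrix.isTotallyPositive_binomMatrix hz).submatrix Fin.val_strictMono Fin.val_strictMono).mul
    (((Matrix.isTotallyPositive_shiftAdd hx).submatrix Fin.val_strictMono Fin.val_strictMono).mul
      ((Matrix.isTotallyPositive_geomMatrix hy).submatrix Fin.val_strictMono Fin.val_strictMono))

end ProductionMatrix

/-- the sequence `(T_n(x,y,z))_{n ≥ 0}` is coefficientwise
Hankel-totally positive: every minor of the Hankel matrix
`(T_{n+n'}(x,y,z))_{n,n' ≥ 0}` is a polynomial in `x, y, z` with nonnegative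
coefficients. -/
theorem TnXYZ_hankel_coefficientwise_totallyPositive :
    ∀ (k : ℕ) (rows cols : Fin k → ℕ), StrictMono rows → StrictMono cols →
      ∀ m : Fin 3 →₀ ℕ,
        0 ≤ MvPolynomial.coeff m
          ((Matrix.of fun a b => TnXYZ (rows a + cols b)).det) := by
  intro k rows cols hrows hcols m
  obtain ⟨N, hN⟩ : ∃ N, ∀ a b, rows a + cols b ≤ N :=
    ⟨∑ a, rows a + ∑ b, cols b, fun a b => add_le_add
      (Finset.single_le_sum (fun _ _ => Nat.zero_le _) (Finset.mem_univ a))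
      (Finset.single_le_sum (fun _ _ => Nat.zero_le _) (Finset.mem_univ b))⟩
  have hQ := (isTotallyPositive_truncProductionMatrix (MvPolynomial.X_mem_nonnegCoeffs (1 : Fin 3))
    (MvPolynomial.X_mem_nonnegCoeffs 2) (MvPolynomial.X_mem_nonnegCoeffs 0) N).hankel
  have h := hQ k rows cols hrows hcols m
  convert h using 3
  ext1 a b
  rw [Matrix.of_apply, TnXYZ_eq_treeSeq, treeSeq_eq_truncProductionMatrix_pow _ _ _ (hN a b)]
  rfl
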